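/- The even hyperbolic lattice U ⊕ E₈ ⊕ E₇ ⊕ A₁ ⊕ A₁ (the 2-elementary lattice with invariants (r,a,δ) = (19,3,1)) is not reflective: the subgroup W_r of O(S) generated by reflections in all roots has infinite index in O(S). -/

import Mathlib

open Matrix

/-- The bilinear form on `ℤⁿ` associated to a Gram matrix `G`. -/
def bform {n : ℕ} (G : Matrix (Fin n) (Fin n) ℤ) (x y : Fin n → ℤ) : ℤ :=
  x ⬝ᵥ G.mulVec y

/-- The orthogonal group `O(S)` of the lattice with Gram matrix `G`:
all `ℤ`-module automorphisms preserving the bilinear form. -/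
def OrthGroup (n : ℕ) (G : Matrix (Fin n) (Fin n) ℤ) :
    Subgroup ((Fin n → ℤ) ≃ₗ[ℤ] (Fin n → ℤ)) where
  carrier := {f | ∀ x y, bform G (f x) (f y) = bform G x y}
  one_mem' := fun _ _ => rfl
  mul_mem' := by
    intro f g hf hg x y
    exact (hf (g x) (g y)).trans (hg x y)
  inv_mem' := by
    intro f hf x y
    have h := (hf (f⁻¹ x) (f⁻¹ y)).symm
    rwa [show f (f⁻¹ x) = x from f.apply_symm_apply x,
      show f (f⁻¹ y) = y from f.apply_symm_apply y] at h

/-- A root: a vector of square `-2`, or of square `-4` whose pairing with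
the whole lattice is even. -/
def IsRoot {n : ℕ} (G : Matrix (Fin n) (Fin n) ℤ) (α : Fin n → ℤ) : Prop :=
  bform G α α = -2 ∨ (bform G α α = -4 ∧ ∀ x : Fin n → ℤ, (2 : ℤ) ∣ bform G α x)

/-- `f` is the reflection in a root `α`. -/
def IsReflection {n : ℕ} (G : Matrix (Fin n) (Fin n) ℤ)
    (f : (Fin n → ℤ) ≃ₗ[ℤ] (Fin n → ℤ)) : Prop :=
  ∃ α : Fin n → ℤ, IsRoot G α ∧
    ∀ x : Fin n → ℤ, f x = x - ((2 * bform G x α) / bform G α α) • α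

/-- The subgroup `W_r` of `O(S)` generated by the reflections in all roots. -/
def Wr (n : ℕ) (G : Matrix (Fin n) (Fin n) ℤ) : Subgroup ↥(OrthGroup n G) :=
  Subgroup.closure {f | IsReflection G f.val}

open Matrix

/-- Orthogonal direct sum of two Gram matrices. -/
def dsum {m k : ℕ} (A : Matrix (Fin m) (Fin m) ℤ) (B : Matrix (Fin k) (Fin k) ℤ) :
    Matrix (Fin (m + k)) (Fin (m + k)) ℤ :=
  Matrix.reindex finSumFinEquiv finSumFinEquiv (Matrix.fromBlocks A 0 0 B)

/-- Gram matrix of the hyperbolic plane `U`. -/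
def gramU : Matrix (Fin 2) (Fin 2) ℤ := !![0, 1; 1, 0]

/-- Gram matrix of `A₁ = ⟨-2⟩`. -/
def gramA1 : Matrix (Fin 1) (Fin 1) ℤ := !![-2]

/-- Gram matrix (= negative Cartan matrix) of a simply laced root lattice with
given Dynkin diagram edges. -/
def adjGram (n : ℕ) (E : List (ℕ × ℕ)) : Matrix (Fin n) (Fin n) ℤ :=
  Matrix.of fun i j =>
    if i = j then -2 else if (i.1, j.1) ∈ E ∨ (j.1, i.1) ∈ E then 1 else 0

/-- Gram matrix of the negative definite root lattice `Dₙ`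
(in the root basis `e₁+e₂, e₂-e₁, e₃-e₂, …, eₙ-eₙ₋₁` of `{x ∈ ℤⁿ : Σxᵢ even}`
with the negative of the standard Euclidean form). -/
def gramD (n : ℕ) : Matrix (Fin n) (Fin n) ℤ :=
  adjGram n ((0, 2) :: (List.range (n - 2)).map fun k => (k + 1, k + 2))

/-- Gram matrix (negative Cartan matrix) of `E₈`. -/
def gramE8 : Matrix (Fin 8) (Fin 8) ℤ :=
  adjGram 8 [(0, 2), (1, 3), (2, 3), (3, 4), (4, 5), (5, 6), (6, 7)]

/-- Gram matrix (negative Cartan matrix) of `E₇`. -/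
def gramE7 : Matrix (Fin 7) (Fin 7) ℤ :=
  adjGram 7 [(0, 2), (1, 3), (2, 3), (3, 4), (4, 5), (5, 6)]

/-- The Gram matrix of the even 2-elementary hyperbolic lattice `U ⊕ E₈ ⊕ E₇ ⊕ A₁ ⊕ A₁`,
with invariants `(r,a,δ) = (19,3,1)`. -/
def gramS :=
  dsum gramU (dsum gramE8 (dsum gramE7 (dsum gramA1 gramA1)))

section BilinearForm

variable {n : ℕ} {G : Matrix (Fin n) (Fin n) ℤ}

theorem bform_add_left (x y z : Fin n → ℤ) :
    bform G (x + y) z = bform G x z + bform G y z := by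
  simp [bform, add_dotProduct]

theorem bform_sub_left (x y z : Fin n → ℤ) :
    bform G (x - y) z = bform G x z - bform G y z := by
  simp [bform, sub_dotProduct]

theorem bform_neg_left (x y : Fin n → ℤ) : bform G (-x) y = -bform G x y := by
  simp [bform]

theorem bform_smul_left (c : ℤ) (x y : Fin n → ℤ) :
    bform G (c • x) y = c * bform G x y := by
  rw [bform, smul_dotProduct, smul_eq_mul, bform]

theorem bform_add_right (x y z : Fin n → ℤ) :
    bform G x (y + z) = bform G x y + bform G x z := by
  simp [bform, mulVec_add, dotProduct_add]

theorem bform_sub_right (x y z : Fin n → ℤ) :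
    bform G x (y - z) = bform G x y - bform G x z := by
  simp [bform, mulVec_sub, dotProduct_sub]

theorem bform_neg_right (x y : Fin n → ℤ) : bform G x (-y) = -bform G x y := by
  simp [bform, mulVec_neg]

theorem bform_smul_right (c : ℤ) (x y : Fin n → ℤ) :
    bform G x (c • y) = c * bform G x y := by
  rw [bform, mulVec_smul, dotProduct_smul, smul_eq_mul, bform]

theorem bform_comm (hG : G.IsSymm) (x y : Fin n → ℤ) : bform G x y = bform G y x := by
  rw [bform, bform, dotProduct_mulVec, ← mulVec_transpose, hG.eq, dotProduct_comm]

end BilinearForm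

section Reflections

variable {n : ℕ} {G : Matrix (Fin n) (Fin n) ℤ}

theorem IsRoot.neg {α : Fin n → ℤ} (hα : IsRoot G α) : IsRoot G (-α) := by
  simpa [IsRoot, bform_neg_left, bform_neg_right] using hα

theorem IsRoot.map {α : Fin n → ℤ} (hα : IsRoot G α) (f : OrthGroup n G) :
    IsRoot G (f.val α) := by
  rcases hα with h | ⟨h, hx⟩
  · exact Or.inl ((f.2 α α).trans h)
  · refine Or.inr ⟨(f.2 α α).trans h, fun x => ?_⟩
    rw [← f.val.apply_symm_apply x, f.2]
    exact hx _

theorem IsRoot.self_ne_zero {α : Fin n → ℤ} (hα : IsRoot G α) : bform G α α ≠ 0 := by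
  rcases hα with h | ⟨h, -⟩ <;> omega

/-- The isometry `s` is the reflection in the root `α`. -/
def ReflectsIn (s : OrthGroup n G) (α : Fin n → ℤ) : Prop :=
  IsRoot G α ∧ ∀ x, ∃ c : ℤ, c * bform G α α = 2 * bform G x α ∧ s.val x = x - c • α

theorem isReflection_iff (hG : G.IsSymm) (s : OrthGroup n G) :
    IsReflection G s.val ↔ ∃ α, ReflectsIn s α := by
  constructor
  · rintro ⟨α, hα, h⟩
    refine ⟨α, hα, fun x => ⟨_, ?_, h x⟩⟩
    apply Int.ediv_mul_cancel
    rcases hα with h | ⟨h, h2⟩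
    · rw [h, neg_dvd]; exact dvd_mul_right _ _
    · have := h2 x
      rw [bform_comm hG] at this
      rw [h, neg_dvd]; exact mul_dvd_mul_left 2 this
  · rintro ⟨α, hα, h⟩
    refine ⟨α, hα, fun x => ?_⟩
    obtain ⟨c, hc, hs⟩ := h x
    rw [hs, ← hc, Int.mul_ediv_cancel _ hα.self_ne_zero]

theorem exists_reflectsIn (hG : G.IsSymm) {α : Fin n → ℤ} (hα : IsRoot G α) :
    ∃ s : OrthGroup n G, ReflectsIn s α := by
  have hc : ∀ x, ∃ c : ℤ, c * bform G α α = 2 * bform G x α := by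
    intro x
    rcases hα with h | ⟨h, h2⟩
    · exact ⟨-bform G x α, by rw [h]; ring⟩
    · obtain ⟨k, hk⟩ := h2 x
      exact ⟨-k, by rw [h, bform_comm hG x, hk]; ring⟩
  choose c hc using hc
  have hα0 := hα.self_ne_zero
  let r : (Fin n → ℤ) →ₗ[ℤ] (Fin n → ℤ) :=
    { toFun := fun x => x - c x • α
      map_add' := fun x y => by
        have : c (x + y) = c x + c y := by
          apply mul_right_cancel₀ hα0
          rw [add_mul, hc, hc, hc, bform_add_left]; ring
        rw [this, add_smul]; abel
      map_smul' := fun k x => by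
        have : c (k • x) = k * c x := by
          apply mul_right_cancel₀ hα0
          rw [mul_assoc, hc, hc, bform_smul_left]; ring
        simp only [this, RingHom.id_apply, smul_sub, mul_smul] }
  have hr : Function.Involutive r := fun x => by
    have : c (x - c x • α) = -c x := by
      apply mul_right_cancel₀ hα0
      rw [neg_mul, hc, hc, bform_sub_left, bform_smul_left, mul_sub, hc]; ring
    change x - c x • α - c (x - c x • α) • α = x
    rw [this, neg_smul]; abel
  refine ⟨⟨LinearEquiv.ofInvolutive r hr, fun x y => ?_⟩, hα, fun x => ⟨c x, hc x, rfl⟩⟩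
  change bform G (x - c x • α) (y - c y • α) = _
  simp only [bform_sub_left, bform_sub_right, bform_smul_left, bform_smul_right]
  apply mul_right_cancel₀ hα0
  rw [bform_comm hG α y]
  linear_combination (c y * bform G α α - bform G y α) * hc x + bform G x α * hc y

namespace ReflectsIn

variable {s t : OrthGroup n G} {α : Fin n → ℤ}

protected theorem neg (h : ReflectsIn s α) : ReflectsIn s (-α) := by
  refine ⟨h.1.neg, fun x => ?_⟩
  obtain ⟨c, hc, hs⟩ := h.2 x
  refine ⟨-c, ?_, by rw [hs]; simp⟩
  simp only [bform_neg_left, bform_neg_right]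
  linear_combination -hc

theorem apply_self (h : ReflectsIn s α) : s.val α = -α := by
  obtain ⟨c, hc, hs⟩ := h.2 α
  have : c = 2 := mul_right_cancel₀ h.1.self_ne_zero hc
  rw [hs, this, two_smul]; abel

theorem unique (hs : ReflectsIn s α) (ht : ReflectsIn t α) : s = t := by
  apply Subtype.ext
  ext1 x
  obtain ⟨c, hc, h⟩ := hs.2 x
  obtain ⟨d, hd, h'⟩ := ht.2 x
  rw [h, h', mul_right_cancel₀ hs.1.self_ne_zero (hc.trans hd.symm)]

theorem conj (h : ReflectsIn s α) (w : OrthGroup n G) :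
    ReflectsIn (w * s * w⁻¹) (w.val α) := by
  refine ⟨h.1.map w, fun x => ?_⟩
  obtain ⟨c, hc, hs⟩ := h.2 ((w⁻¹).val x)
  have hx : w.val ((w⁻¹).val x) = x := w.val.apply_symm_apply x
  refine ⟨c, ?_, ?_⟩
  · rw [w.2, hc, ← w.2 _ α, hx]
  · change w.val (s.val ((w⁻¹).val x)) = _
    rw [hs, map_sub, map_smul, hx]

theorem mul_self (h : ReflectsIn s α) : s * s = 1 := by
  apply Subtype.ext
  ext1 x
  obtain ⟨c, -, hs⟩ := h.2 x
  change s.val (s.val x) = x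
  rw [hs, map_sub, map_smul, h.apply_self, hs, smul_neg]; abel

theorem inv_eq (h : ReflectsIn s α) : s⁻¹ = s :=
  inv_eq_of_mul_eq_one_left h.mul_self

end ReflectsIn

end Reflections

section Chambers

variable {n : ℕ} {G : Matrix (Fin n) (Fin n) ℤ} {p : Fin n → ℤ}

/-- A root `α` positive at `p` such that its reflection makes no other positive root negative:
the mirror of `α` is a wall of the chamber of `p`. -/
def IsSimpleRoot (G : Matrix (Fin n) (Fin n) ℤ) (p α : Fin n → ℤ) : Prop :=
  IsRoot G α ∧ 0 < bform G α p ∧ ∀ γ, IsRoot G γ → 0 < bform G γ p →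
    ∀ s : OrthGroup n G, ReflectsIn s α → bform G (s.val γ) p < 0 → γ = α

/-- The set of reflections in the simple roots. -/
def simpleReflections (G : Matrix (Fin n) (Fin n) ℤ) (p : Fin n → ℤ) : Set (OrthGroup n G) :=
  {s | ∃ α, IsSimpleRoot G p α ∧ ReflectsIn s α}

/-- The exchange condition. -/
theorem exists_shorter_prod (hgen : ∀ α, IsRoot G α → bform G α p ≠ 0)
    {α : Fin n → ℤ} {s : OrthGroup n G} (hα : IsSimpleRoot G p α) (hs : ReflectsIn s α) :
    ∀ l : List (OrthGroup n G), (∀ t ∈ l, t ∈ simpleReflections G p) →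
      bform G (l.prod.val α) p < 0 →
      ∃ l' : List (OrthGroup n G), (∀ t ∈ l', t ∈ simpleReflections G p) ∧
        l'.length < l.length ∧ l.prod * s = l'.prod
  | [], _, h => absurd h (not_lt.2 hα.2.1.le)
  | t :: l, hl, h => by
    have hl' : ∀ t ∈ l, t ∈ simpleReflections G p := fun u hu => hl u (List.mem_cons_of_mem _ hu)
    rw [List.prod_cons] at h ⊢
    rcases lt_or_gt_of_ne (hgen _ (hα.1.map l.prod)) with hneg | hpos
    · obtain ⟨l', h1, h2, h3⟩ := exists_shorter_prod hgen hα hs l hl' hneg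
      refine ⟨t :: l', ?_, by simpa using h2, by rw [List.prod_cons, mul_assoc, h3]⟩
      rintro u (_ | ⟨_, hu⟩)
      · exact hl t List.mem_cons_self
      · exact h1 u hu
    · obtain ⟨β, hβ, ht⟩ := hl t List.mem_cons_self
      have hβα := hβ.2.2 _ (hα.1.map l.prod) hpos t ht h
      have htc : t = l.prod * s * l.prod⁻¹ := ht.unique (hβα ▸ hs.conj l.prod)
      refine ⟨l, hl', by simp, ?_⟩
      rw [htc]
      simp only [mul_assoc, inv_mul_cancel_left, hs.mul_self, mul_one]

theorem prod_eq_one_of_preserves_positive (hgen : ∀ α, IsRoot G α → bform G α p ≠ 0) (N : ℕ) :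
    ∀ l : List (OrthGroup n G), l.length < N → (∀ t ∈ l, t ∈ simpleReflections G p) →
      (∀ α, IsRoot G α → 0 < bform G α p → 0 < bform G (l.prod.val α) p) → l.prod = 1 := by
  induction N with
  | zero => intro l hl; simp at hl
  | succ N ih =>
    intro l hlen hl hpos
    rcases List.eq_nil_or_concat' l with rfl | ⟨l, s, rfl⟩
    · rfl
    · obtain ⟨α, hα, hs⟩ := hl s (by simp)
      have hl' : ∀ t ∈ l, t ∈ simpleReflections G p := fun t ht => hl t (by simp [ht])
      have h1 : (l ++ [s]).prod = l.prod * s := by simp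
      have h2 := hpos α hα.1 hα.2.1
      rw [h1] at h2 hpos ⊢
      have h3 : (l.prod * s).val α = -(l.prod.val α) := by
        change l.prod.val (s.val α) = _
        rw [hs.apply_self, map_neg]
      rw [h3, bform_neg_left, neg_pos] at h2
      obtain ⟨l', hs', hlen', hprod⟩ := exists_shorter_prod hgen hα hs l hl' h2
      rw [hprod] at hpos ⊢
      refine ih l' ?_ hs' hpos
      simp at hlen
      omega

theorem eq_one_of_mem_closure (hgen : ∀ α, IsRoot G α → bform G α p ≠ 0) {w : OrthGroup n G}
    (hw : w ∈ Subgroup.closure (simpleReflections G p))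
    (hpos : ∀ α, IsRoot G α → 0 < bform G α p → 0 < bform G (w.val α) p) : w = 1 := by
  rw [← Subgroup.mem_toSubmonoid, Subgroup.closure_toSubmonoid] at hw
  obtain ⟨l, hl, rfl⟩ := Submonoid.exists_list_of_mem_closure hw
  refine prod_eq_one_of_preserves_positive hgen _ l (Nat.lt_succ_self _) (fun t ht => ?_) hpos
  rcases hl t ht with h | ⟨α, hα, h⟩
  · exact h
  · refine ⟨α, hα, ?_⟩
    have := h.inv_eq
    rw [inv_inv] at this
    rwa [this]

/-- Of two positive roots `β ≠ γ` for which `γ` is the lower one of the pair `γ`, `-s_β γ`,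
the root `γ` is closer to `p`, and `s_γ` brings the mirror of `β` closer to `p`. -/
theorem closer_of_lower (hG : G.IsSymm)
    (hneg : ∀ x, bform G x p = 0 → x ≠ 0 → bform G x x < 0) {β γ : Fin n → ℤ}
    (hβ : IsRoot G β) (hγ : IsRoot G γ) (hβp : 0 < bform G β p) (hγp : 0 < bform G γ p)
    (hne : γ ≠ β)
    (hlow : -bform G β β * bform G γ p ≤ -bform G γ β * bform G β p) :
    -bform G γ β * bform G γ p < -bform G γ γ * bform G β p ∧
      -bform G β β * bform G γ p ^ 2 < -bform G γ γ * bform G β p ^ 2 := by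
  have hbpos : 0 < -bform G β β := by rcases hβ with h | ⟨h, -⟩ <;> omega
  have hgpos : 0 < -bform G γ γ := by rcases hγ with h | ⟨h, -⟩ <;> omega
  set v := bform G β p • γ - bform G γ p • β with hv
  have hvp : bform G v p = 0 := by
    rw [hv, bform_sub_left, bform_smul_left, bform_smul_left]; ring
  have hv0 : v ≠ 0 := by
    intro h0
    have h1 : bform G v β = 0 := by rw [h0]; simp [bform]
    have h2 : bform G v γ = 0 := by rw [h0]; simp [bform]
    rw [hv, bform_sub_left, bform_smul_left, bform_smul_left] at h1 h2
    rw [bform_comm hG β γ] at h2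
    have key : bform G β β = bform G γ γ → False := by
      intro he
      rw [he] at h1
      have : (bform G β p - bform G γ p) * (bform G γ β + bform G γ γ) = 0 := by
        linear_combination h1 + h2
      rcases mul_eq_zero.1 this with h | h
      · apply hne
        rw [hv, ← sub_eq_zero.1 h, ← smul_sub] at h0
        exact sub_eq_zero.1 ((smul_eq_zero.1 h0).resolve_left hβp.ne')
      · have : bform G γ β = -bform G γ γ := by linarith
        rw [this] at h2
        nlinarith
    have key2 : ∀ a b k : ℤ, 0 < a → a * k = b → a * 2 = b * k → False := by
      intro a b k ha h1 h2
      have : a * (k ^ 2 - 2) = 0 := by rw [← h1] at h2; linarith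
      rcases mul_eq_zero.1 this with h | h
      · omega
      · have : k < 2 := by nlinarith
        have : -2 < k := by nlinarith
        interval_cases k <;> omega
    rcases hβ with hb | ⟨hb, hb2⟩ <;> rcases hγ with hg | ⟨hg, hg2⟩
    · exact key (hb.trans hg.symm)
    · obtain ⟨k, hk⟩ := hg2 β
      rw [hb, hk] at h1
      rw [hg, hk] at h2
      exact key2 (bform G β p) (bform G γ p) (-k) hβp (by linarith) (by linarith)
    · obtain ⟨k, hk⟩ := hb2 γ
      rw [bform_comm hG] at hk
      rw [hb, hk] at h1
      rw [hg, hk] at h2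
      exact key2 (bform G γ p) (bform G β p) (-k) hγp (by linarith) (by linarith)
    · exact key (hb.trans hg.symm)
  have hQ := hneg v hvp hv0
  have hQ' : 0 < bform G β p * (-bform G γ γ * bform G β p - -bform G γ β * bform G γ p) +
      bform G γ p * (-bform G β β * bform G γ p - -bform G γ β * bform G β p) := by
    simp only [hv, bform_sub_left, bform_sub_right, bform_smul_left, bform_smul_right,
      bform_comm hG β γ] at hQ
    linarith
  have h1 : -bform G γ β * bform G γ p < -bform G γ γ * bform G β p := by
    by_contra! h
    have := mul_nonneg hβp.le (sub_nonneg.2 h)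
    have := mul_nonneg hγp.le (sub_nonneg.2 hlow)
    linarith
  refine ⟨h1, ?_⟩
  have h2 := mul_le_mul_of_nonneg_right hlow hγp.le
  have h3 := mul_lt_mul_of_pos_right h1 hβp
  linarith

theorem exists_lower_root {β : Fin n → ℤ} {s : OrthGroup n G} (hs : ReflectsIn s β)
    (hβp : 0 < bform G β p) (hβ : ¬ IsSimpleRoot G p β) :
    ∃ γ, IsRoot G γ ∧ 0 < bform G γ p ∧ γ ≠ β ∧
      -bform G β β * bform G γ p ≤ -bform G γ β * bform G β p := by
  simp only [IsSimpleRoot, hs.1, hβp, true_and, not_forall] at hβ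
  obtain ⟨γ, hγ, hγp, t, ht, hlt, hne⟩ := hβ
  obtain rfl := ht.unique hs
  obtain ⟨c, hc, hsγ⟩ := hs.2 γ
  rcases le_total (bform G γ p) (-bform G (t.val γ) p) with hle | hle
  · refine ⟨γ, hγ, hγp, hne, ?_⟩
    rw [hsγ, bform_sub_left, bform_smul_left] at hle
    have hbpos : 0 < -bform G β β := by rcases hs.1 with h | ⟨h, -⟩ <;> omega
    nlinarith [mul_le_mul_of_nonneg_left hle hbpos.le]
  · refine ⟨-t.val γ, (hγ.map t).neg, by rw [bform_neg_left]; omega, ?_, ?_⟩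
    · intro h
      apply hne
      apply t.val.injective
      rw [hs.apply_self, ← h, neg_neg]
    · have h1 : bform G (-t.val γ) β = bform G γ β := by
        rw [← t.2 γ β, hs.apply_self, bform_neg_left, bform_neg_right]
      rw [h1, bform_neg_left]
      rw [hsγ, bform_sub_left, bform_smul_left] at hle ⊢
      have hbpos : 0 < -bform G β β := by rcases hs.1 with h | ⟨h, -⟩ <;> omega
      nlinarith [mul_le_mul_of_nonneg_left hle hbpos.le]

theorem reflection_mem_closure_simple (hG : G.IsSymm)
    (hneg : ∀ x, bform G x p = 0 → x ≠ 0 → bform G x x < 0)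
    (hgen : ∀ α, IsRoot G α → bform G α p ≠ 0) (N : ℕ) :
    ∀ (β : Fin n → ℤ) (s : OrthGroup n G), ReflectsIn s β → 0 < bform G β p →
      4 * bform G β p ^ 2 < N * -bform G β β →
      s ∈ Subgroup.closure (simpleReflections G p) := by
  induction N with
  | zero => intro β s _ _ h; rw [Nat.cast_zero] at h; nlinarith [sq_nonneg (bform G β p)]
  | succ N ih =>
    intro β s hs hβp hN
    push_cast at hN
    by_cases hsimple : IsSimpleRoot G p β
    · exact Subgroup.subset_closure ⟨β, hsimple, hs⟩
    obtain ⟨γ, hγ, hγp, hne, hlow⟩ := exists_lower_root hs hβp hsimple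
    obtain ⟨h1, h2⟩ := closer_of_lower hG hneg hs.1 hγ hβp hγp hne hlow
    obtain ⟨t, ht⟩ := exists_reflectsIn hG hγ
    have htmem : t ∈ Subgroup.closure (simpleReflections G p) := by
      refine ih γ t ht hγp ?_
      rcases hs.1 with hb | ⟨hb, -⟩ <;> rcases hγ with hg | ⟨hg, -⟩ <;>
        rw [hb] at h2 hN <;> rw [hg] at h2 ⊢ <;> omega
    have hconj := hs.conj t
    have hβ' := hs.1.map t
    have hself : bform G (t.val β) (t.val β) = bform G β β := t.2 β β
    have habs : bform G (t.val β) p < bform G β p ∧ -bform G β p < bform G (t.val β) p := by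
      obtain ⟨c, hc, htβ⟩ := ht.2 β
      have hgpos : 0 < -bform G γ γ := by rcases hγ with h | ⟨h, -⟩ <;> omega
      have hkpos : 0 < -bform G γ β := by
        have hbpos : 0 < -bform G β β := by rcases hs.1 with h | ⟨h, -⟩ <;> omega
        exact pos_of_mul_pos_left ((mul_pos hbpos hγp).trans_le hlow) hβp.le
      rw [bform_comm hG β γ] at hc
      have hcpos : 0 < c := pos_of_mul_pos_left (by linarith : 0 < c * -bform G γ γ) hgpos.le
      rw [htβ, bform_sub_left, bform_smul_left]
      refine ⟨by nlinarith, ?_⟩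
      have : -bform G γ γ * (c * bform G γ p) < -bform G γ γ * (2 * bform G β p) := by
        have : -bform G γ γ * (c * bform G γ p) = 2 * (-bform G γ β * bform G γ p) := by
          linear_combination -bform G γ p * hc
        linarith
      linarith [lt_of_mul_lt_mul_left this hgpos.le]
    have hN' : 4 * bform G (t.val β) p ^ 2 < N * -bform G β β := by
      have h3 : bform G (t.val β) p ^ 2 < bform G β p ^ 2 := by nlinarith [habs.1, habs.2]
      rcases hs.1 with hb | ⟨hb, -⟩ <;> rw [hb] at hN ⊢ <;> omega
    have hcmem : t * s * t⁻¹ ∈ Subgroup.closure (simpleReflections G p) := by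
      rcases lt_or_gt_of_ne (hgen _ hβ') with h | h
      · refine ih _ _ hconj.neg (by rw [bform_neg_left]; omega) ?_
        rw [bform_neg_left, bform_neg_left, bform_neg_right, neg_neg, hself, neg_sq]
        exact hN'
      · exact ih _ _ hconj h (by rwa [hself])
    have : s = t⁻¹ * (t * s * t⁻¹) * t := by group
    rw [this]
    exact mul_mem (mul_mem (inv_mem htmem) hcmem) htmem

/-- The reflection group acts freely on chambers. -/
theorem eq_one_of_mem_Wr (hG : G.IsSymm)
    (hneg : ∀ x, bform G x p = 0 → x ≠ 0 → bform G x x < 0)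
    (hgen : ∀ α, IsRoot G α → bform G α p ≠ 0) {w : OrthGroup n G} (hw : w ∈ Wr n G)
    (hpos : ∀ α, IsRoot G α → 0 < bform G α p → 0 < bform G (w.val α) p) : w = 1 := by
  refine eq_one_of_mem_closure hgen ?_ hpos
  refine (Subgroup.closure_le _).2 (fun s hs => ?_) hw
  obtain ⟨β, hβ⟩ := (isReflection_iff hG s).1 hs
  have hmem : ∀ β, ReflectsIn s β → 0 < bform G β p →
      s ∈ Subgroup.closure (simpleReflections G p) := fun β hβ h => by
    refine reflection_mem_closure_simple hG hneg hgen (4 * bform G β p ^ 2 + 1).toNat β s hβ h ?_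
    rw [Int.toNat_of_nonneg (by positivity)]
    have : 1 ≤ -bform G β β := by rcases hβ.1 with h | ⟨h, -⟩ <;> omega
    nlinarith [sq_nonneg (bform G β p)]
  rcases lt_or_gt_of_ne (hgen β hβ.1) with h | h
  · exact hmem _ hβ.neg (by rw [bform_neg_left]; omega)
  · exact hmem _ hβ h

end Chambers

section Transvections

variable {n : ℕ} {G : Matrix (Fin n) (Fin n) ℤ}

/-- The Eichler transvection attached to an isotropic vector `e` and a vector `v ∈ e^⊥` with
`⟨v, v⟩ = 2k`. -/
def eichlerFun (G : Matrix (Fin n) (Fin n) ℤ) (e v : Fin n → ℤ) (k : ℤ) :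
    (Fin n → ℤ) →ₗ[ℤ] (Fin n → ℤ) where
  toFun x := x + bform G x e • v - (bform G x v + k * bform G x e) • e
  map_add' x y := by
    simp only [bform_add_left, mul_add, add_smul]; abel
  map_smul' c x := by
    simp only [bform_smul_left, RingHom.id_apply, smul_add, smul_sub, smul_smul]
    ring_nf

theorem exists_eichler (hG : G.IsSymm) {e v : Fin n → ℤ} {k : ℤ} (he : bform G e e = 0)
    (hve : bform G v e = 0) (hv : bform G v v = 2 * k) :
    ∃ g : OrthGroup n G,
      ∀ x, g.val x = x + bform G x e • v - (bform G x v + k * bform G x e) • e := by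
  have hev : bform G e v = 0 := by rw [bform_comm hG, hve]
  have key : ∀ u : Fin n → ℤ, bform G u e = 0 → bform G u u = 2 * k →
      eichlerFun G e u k ∘ₗ eichlerFun G e (-u) k = LinearMap.id := by
    intro u hu huu
    have hu' : bform G e u = 0 := by rw [bform_comm hG, hu]
    refine LinearMap.ext fun x => ?_
    simp only [eichlerFun, LinearMap.comp_apply, LinearMap.coe_mk, AddHom.coe_mk,
      LinearMap.id_apply, bform_add_left, bform_sub_left, bform_smul_left, bform_neg_left,
      bform_neg_right, he, hu, hu', huu]
    module
  have h1 := key v hve hv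
  have h2 := key (-v) (by rw [bform_neg_left, hve, neg_zero])
    (by rw [bform_neg_left, bform_neg_right, neg_neg, hv])
  rw [neg_neg] at h2
  refine ⟨⟨LinearEquiv.ofLinearMap _ _ h1 h2, fun x y => ?_⟩, fun x => rfl⟩
  change bform G (x + bform G x e • v - (bform G x v + k * bform G x e) • e)
    (y + bform G y e • v - (bform G y v + k * bform G y e) • e) = _
  simp only [bform_add_left, bform_sub_left, bform_smul_left, bform_add_right, bform_sub_right,
    bform_smul_right, he, hve, hev, hv, bform_comm hG v y, bform_comm hG e y]
  ring

end Transvections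

section Cusps

variable {n : ℕ} {G : Matrix (Fin n) (Fin n) ℤ}

/-- A criterion for `W_r` to have infinite index: all roots orthogonal to the isotropic vector `e`
are orthogonal to an anisotropic `v ∈ e^⊥`. The vector `p` is a point in the interior of a chamber
that has the cusp `e`. -/
theorem not_finiteIndex_Wr_of_cusp (hG : G.IsSymm) {e p v : Fin n → ℤ} {k : ℤ}
    (he : bform G e e = 0) (hpe : 0 < bform G p e)
    (hpp : 4 * bform G p e ^ 2 < bform G p p)
    (hsemi : ∀ x, bform G x e = 0 → bform G x x ≤ 0)
    (hrad : ∀ x, bform G x e = 0 → bform G x x = 0 → bform G x p = 0 → x = 0)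
    (hve : bform G v e = 0) (hv : bform G v v = 2 * k) (hk : k ≠ 0)
    (hroot : ∀ α, IsRoot G α → bform G α e = 0 → bform G α v = 0 ∧ bform G α p ≠ 0) :
    ¬ (Wr n G).FiniteIndex := by
  intro hfin
  have hneg : ∀ x, bform G x p = 0 → x ≠ 0 → bform G x x < 0 := by
    intro x hx hx0
    have h1 := hsemi (bform G p e • x - bform G x e • p) (by
      rw [bform_sub_left, bform_smul_left, bform_smul_left]; ring)
    simp only [bform_sub_left, bform_sub_right, bform_smul_left, bform_smul_right, hx,
      bform_comm hG p x] at h1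
    have hP : 0 < bform G p p := by nlinarith
    have hm2 : 0 < bform G p e ^ 2 := by positivity
    by_contra! h
    have h2 : 0 ≤ bform G x e ^ 2 * bform G p p := by positivity
    have h3 : 0 ≤ bform G p e ^ 2 * bform G x x := by positivity
    have h4 : bform G x e ^ 2 * bform G p p = 0 := by nlinarith
    have h5 : bform G p e ^ 2 * bform G x x = 0 := by nlinarith
    have h6 : bform G x e = 0 := by simpa [hP.ne'] using h4
    have h7 : bform G x x = 0 := by simpa [hpe.ne'] using h5
    exact hx0 (hrad x h6 h7 hx)
  have hsign : ∀ α, IsRoot G α → bform G α e ≠ 0 → 0 < bform G α e * bform G α p := by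
    intro α hα h0
    have h1 := hsemi (bform G p e • α - bform G α e • p) (by
      rw [bform_sub_left, bform_smul_left, bform_smul_left]; ring)
    simp only [bform_sub_left, bform_sub_right, bform_smul_left, bform_smul_right,
      bform_comm hG p α] at h1
    have h2 : 1 ≤ bform G α e ^ 2 := by
      have : 0 < bform G α e ^ 2 := by positivity
      omega
    have h3 : -4 ≤ bform G α α := by rcases hα with h | ⟨h, -⟩ <;> omega
    have h4 : bform G p p ≤ bform G α e ^ 2 * bform G p p := by nlinarith
    have h5 : bform G p e ^ 2 * -4 ≤ bform G p e ^ 2 * bform G α α :=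
      mul_le_mul_of_nonneg_left h3 (sq_nonneg _)
    have h6 : 0 < bform G p e * (bform G α e * bform G α p) := by nlinarith
    exact pos_of_mul_pos_right h6 hpe.le
  have hgen : ∀ α, IsRoot G α → bform G α p ≠ 0 := by
    intro α hα h
    by_cases h0 : bform G α e = 0
    · exact (hroot α hα h0).2 h
    · have := hsign α hα h0
      rw [h, mul_zero] at this
      exact lt_irrefl _ this
  obtain ⟨g, hg⟩ := exists_eichler hG he hve hv
  obtain ⟨N, hN, -, hmem⟩ := Subgroup.exists_pow_mem_of_index_ne_zero hfin.index_ne_zero g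
  have hev : bform G e v = 0 := by rw [bform_comm hG, hve]
  have hpow_e : ∀ (j : ℕ) (x), bform G ((g ^ j).val x) e = bform G x e := by
    intro j
    induction j with
    | zero => intro x; rfl
    | succ j ih =>
      intro x
      rw [pow_succ]
      change bform G ((g ^ j).val (g.val x)) e = _
      rw [ih, hg]
      simp only [bform_add_left, bform_sub_left, bform_smul_left, he, hve]
      ring
  have hpow_fix : ∀ (j : ℕ) (α), IsRoot G α → bform G α e = 0 → (g ^ j).val α = α := by
    intro j α hα h0
    induction j with
    | zero => rfl
    | succ j ih =>
      rw [pow_succ]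
      change (g ^ j).val (g.val α) = _
      rw [hg, h0, (hroot α hα h0).1]
      simpa using ih
  have hpow_v : ∀ (j : ℕ) (x), bform G ((g ^ j).val x) v =
      bform G x v + j * (bform G x e * (2 * k)) := by
    intro j
    induction j with
    | zero => intro x; simp
    | succ j ih =>
      intro x
      rw [pow_succ]
      change bform G ((g ^ j).val (g.val x)) v = _
      rw [ih, hg]
      simp only [bform_add_left, bform_sub_left, bform_smul_left, he, hve, hev, hv]
      push_cast
      ring
  have hone := eq_one_of_mem_Wr hG hneg hgen hmem (fun α hα hαp => by
    by_cases h0 : bform G α e = 0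
    · rwa [hpow_fix N α hα h0]
    · have h1 := hsign α hα h0
      have h2 := hsign _ (hα.map (g ^ N)) (by rwa [hpow_e])
      rw [hpow_e] at h2
      have h3 : 0 < bform G α e := pos_of_mul_pos_left h1 hαp.le
      exact pos_of_mul_pos_right h2 h3.le)
  have hlast := hpow_v N p
  rw [hone] at hlast
  have h0 : (N : ℤ) * (bform G p e * (2 * k)) = 0 := by
    have : bform G ((1 : OrthGroup n G).val p) v = bform G p v := rfl
    linarith
  simp [hN.ne', hpe.ne', hk] at h0

end Cusps

/-- The functional `⟨·, e⟩` on the lattice, for the isotropic vector `e = cuspVec`. -/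
def pairE : Fin 19 → ℤ :=
  ![4, 4, 0, -3, -1, 2, 2, -4, 2, 1, 3, 1, -4, 3, -2, 0, -1, -2, 2]

/-- The functional `⟨·, f⟩`, for an isotropic vector `f` with `⟨e, f⟩ = 1`. -/
def pairF : Fin 19 → ℤ :=
  ![4, 4, -1, -3, 1, 1, 2, -4, 2, 1, 3, 1, -4, 3, -2, 0, -1, -2, 2]

/-- The coordinates on `e^⊥ / e` in the summand `ℤ³` of its odd overlattice. -/
def coordZ : Matrix (Fin 3) (Fin 19) ℤ :=
  !![0, 0, 0, 0, 0, 0, 0, 0, 0, 0, 0, 0, 0, 0, 0, 0, 0, -1, -1;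
    -2, -2, 0, 2, 0, -1, -1, 2, -1, 0, -2, -1, 2, -1, 1, 0, 0, 1, -1;
    -2, -2, 0, 2, 0, -1, -1, 2, -1, 0, -1, 0, 2, -2, 1, 0, 1, 1, -1]

/-- Together with `coordW`: the coordinates on `e^⊥ / e` in the orthogonal complement
`{(u, w) | ∑ uᵢ = -4w}` of `(1, …, 1; 4)` in the Lorentzian lattice `ℤ^{14,1}`. -/
def coordU : Matrix (Fin 14) (Fin 19) ℤ :=
  !![-1, -1, 0, 1, 0, 0, -1, 1, 0, -1, -1, 0, 1, -1, 1, 0, 0, 0, 0;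
    -1, -1, 1, 1, 0, -1, 0, 1, -1, 0, -1, 0, 1, -1, 1, 0, 0, 0, 0;
    0, 0, 0, 0, 0, 0, 0, 0, 0, 0, 0, 0, 0, 0, 0, 1, -1, 0, 0;
    0, 0, 0, 0, 0, 0, 0, 0, 0, 0, 0, 0, 0, 0, 1, -1, 0, 0, 0;
    -1, -1, 0, 0, 0, 0, -1, 2, -1, 0, -1, 0, 1, -1, 1, 0, 0, 0, 0;
    -1, 0, 0, 0, 0, 0, 0, 0, 0, 0, -1, 0, 1, -1, 1, 0, 0, 0, 0;
    0, -1, 0, 0, 0, 0, 0, 0, 0, 0, -1, 0, 1, -1, 1, 0, 0, 0, 0;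
    0, 0, 0, 0, 0, 0, 0, 0, 0, 0, -1, 1, 0, 0, 0, 0, 0, 0, 0;
    3, 3, -1, -2, 0, 1, 2, -3, 1, 1, 2, 1, -3, 2, -1, 0, -1, -2, 2;
    0, 0, 0, 0, 0, 0, 0, 0, 0, 0, 0, 0, -1, 0, 1, 0, 0, 0, 0;
    0, 0, 0, 0, 0, 0, 0, 0, 0, 0, 0, 1, 0, -1, 1, 0, -1, 0, 0;
    3, 3, 0, -2, 0, 1, 1, -3, 2, 1, 2, 1, -3, 2, -1, 0, -1, -2, 2;
    -1, -1, 0, 1, 0, -1, 0, 1, 0, -1, -1, 0, 1, -1, 1, 0, 0, 0, 0;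
    -1, -1, 0, 1, 0, 0, -1, 1, -1, 0, -1, 0, 1, -1, 1, 0, 0, 0, 0]

/-- The timelike coordinate accompanying `coordU`. -/
def coordW : Fin 19 → ℤ :=
  ![0, 0, 0, 0, 0, 0, 0, 0, 0, 0, 1, -1, 0, 1, -2, 0, 1, 1, -1]

/-- An isotropic vector `e` such that the roots of `e^⊥ / e` span a sublattice of rank 16. -/
def cuspVec : Fin 19 → ℤ :=
  ![4, 4, 0, 1, 0, -1, -1, 1, -1, -1, -1, -1, 1, -1, 1, 1, 1, 1, -1]

/-- A vector of positive square in the interior of a chamber with cusp `cuspVec`. -/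
def chamberVec : Fin 19 → ℤ :=
  ![236, 235, -25, 31, -60, -122, -110, 21, -82, -68, -62, -55, 55, -60, 64, 61, 59, 56, -57]

/-- A vector of `e^⊥` orthogonal to all roots of `e^⊥`. -/
def transVec : Fin 19 → ℤ :=
  ![0, 0, 0, 0, 0, 0, 0, 0, 0, 0, 2, 6, 6, 10, 10, 6, 2, -1, 1]

/-- The simple roots of a root system `A₁₃` in `e^⊥`. -/
def rootsA13 : Matrix (Fin 13) (Fin 19) ℤ :=
  !![0, 0, 0, 1, 1, 2, 1, 1, 1, 0, 0, 0, 0, 0, 0, 0, 0, 0, 0;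
    1, 1, 1, 1, 1, 1, 1, 1, 0, 0, -1, -1, -1, -2, -1, -1, 0, 0, 0;
    0, 0, 0, 0, 0, 0, 0, 0, 0, 0, 0, 0, 0, 0, 0, 1, 0, 0, 0;
    -1, -1, 0, 0, 0, 0, 0, -1, 0, 0, 1, 1, 1, 2, 1, 0, 0, 0, 0;
    1, 0, 0, 0, 0, 0, 0, 1, 0, 0, 0, 0, 0, 0, 0, 0, 0, 0, 0;
    -1, 1, 0, 0, 0, 0, 0, 0, 0, 0, 0, 0, 0, 0, 0, 0, 0, 0, 0;
    1, 0, 0, 0, 0, 0, 0, 0, 0, 0, 0, -1, 0, -1, 0, 0, 0, 0, 0;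
    3, 3, 0, 0, -1, -2, -2, 0, -1, -1, -1, 0, 1, 0, 1, 1, 1, 1, -1;
    -3, -3, 0, 0, 1, 2, 2, 0, 1, 1, 1, 1, 0, 1, -1, -1, -1, -1, 1;
    0, 0, 0, 0, 0, 0, 0, 0, 0, 0, 0, 0, 0, 1, 1, 1, 1, 0, 0;
    3, 3, 0, 1, 0, 0, 0, 1, -1, -1, -1, -1, 0, -2, 0, 0, 0, 1, -1;
    -4, -4, 1, 0, 2, 3, 2, 0, 2, 2, 1, 1, -1, 1, -1, -1, -1, -1, 1;
    0, 0, 0, 0, 0, 0, 1, 1, 1, 0, 0, 0, 0, 0, 0, 0, 0, 0, 0]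

/-- Twice the inverse of the Gram matrix `gramS`. -/
def gramSInv : Matrix (Fin 19) (Fin 19) ℤ :=
  !![0, 2, 0, 0, 0, 0, 0, 0, 0, 0, 0, 0, 0, 0, 0, 0, 0, 0, 0;
    2, 0, 0, 0, 0, 0, 0, 0, 0, 0, 0, 0, 0, 0, 0, 0, 0, 0, 0;
    0, 0, -8, -10, -14, -20, -16, -12, -8, -4, 0, 0, 0, 0, 0, 0, 0, 0, 0;
    0, 0, -10, -16, -20, -30, -24, -18, -12, -6, 0, 0, 0, 0, 0, 0, 0, 0, 0;
    0, 0, -14, -20, -28, -40, -32, -24, -16, -8, 0, 0, 0, 0, 0, 0, 0, 0, 0;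
    0, 0, -20, -30, -40, -60, -48, -36, -24, -12, 0, 0, 0, 0, 0, 0, 0, 0, 0;
    0, 0, -16, -24, -32, -48, -40, -30, -20, -10, 0, 0, 0, 0, 0, 0, 0, 0, 0;
    0, 0, -12, -18, -24, -36, -30, -24, -16, -8, 0, 0, 0, 0, 0, 0, 0, 0, 0;
    0, 0, -8, -12, -16, -24, -20, -16, -12, -6, 0, 0, 0, 0, 0, 0, 0, 0, 0;
    0, 0, -4, -6, -8, -12, -10, -8, -6, -4, 0, 0, 0, 0, 0, 0, 0, 0, 0;
    0, 0, 0, 0, 0, 0, 0, 0, 0, 0, -4, -4, -6, -8, -6, -4, -2, 0, 0;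
    0, 0, 0, 0, 0, 0, 0, 0, 0, 0, -4, -7, -8, -12, -9, -6, -3, 0, 0;
    0, 0, 0, 0, 0, 0, 0, 0, 0, 0, -6, -8, -12, -16, -12, -8, -4, 0, 0;
    0, 0, 0, 0, 0, 0, 0, 0, 0, 0, -8, -12, -16, -24, -18, -12, -6, 0, 0;
    0, 0, 0, 0, 0, 0, 0, 0, 0, 0, -6, -9, -12, -18, -15, -10, -5, 0, 0;
    0, 0, 0, 0, 0, 0, 0, 0, 0, 0, -4, -6, -8, -12, -10, -8, -4, 0, 0;
    0, 0, 0, 0, 0, 0, 0, 0, 0, 0, -2, -3, -4, -6, -5, -4, -3, 0, 0;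
    0, 0, 0, 0, 0, 0, 0, 0, 0, 0, 0, 0, 0, 0, 0, 0, 0, -1, 0;
    0, 0, 0, 0, 0, 0, 0, 0, 0, 0, 0, 0, 0, 0, 0, 0, 0, 0, -1]

section ShortVectors

variable {u : Fin 14 → ℤ} {z : Fin 3 → ℤ} {w : ℤ}

theorem sq_le_of_sum_eq (hsum : ∑ i, u i = -4 * w) : 8 * w ^ 2 ≤ 7 * ∑ i, u i ^ 2 := by
  have h := sq_sum_le_card_mul_sum_sq (s := Finset.univ) (f := u)
  rw [hsum, Finset.card_univ, Fintype.card_fin] at h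
  push_cast at h
  linarith

theorem sum_mul_add_nonneg {a b : ℤ} (h : ∀ i, 0 ≤ u i ^ 2 + a * u i + b) :
    0 ≤ ∑ i, u i ^ 2 + a * ∑ i, u i + 14 * b := by
  have := Finset.sum_nonneg fun i (_ : i ∈ Finset.univ) => h i
  simpa [Finset.sum_add_distrib, Finset.mul_sum] using this

theorem timelike_eq_zero_of_norm_two (hsum : ∑ i, u i = -4 * w)
    (hnorm : ∑ i, z i ^ 2 + ∑ i, u i ^ 2 = w ^ 2 + 2) : w = 0 := by
  have hz : 0 ≤ ∑ i, z i ^ 2 := Finset.sum_nonneg fun i _ => sq_nonneg _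
  have hc := sq_le_of_sum_eq hsum
  have h1 := sum_mul_add_nonneg (u := u) (a := 1) (b := 0) fun i => by
    rcases le_or_gt 0 (u i) with h | h <;> nlinarith
  have h2 := sum_mul_add_nonneg (u := u) (a := -1) (b := 0) fun i => by
    rcases le_or_gt (u i) 0 with h | h <;> nlinarith
  rw [hsum] at h1 h2
  have hw1 : w ≤ 3 := by nlinarith
  have hw2 : -3 ≤ w := by nlinarith
  interval_cases w <;> omega

theorem timelike_eq_zero_of_norm_four (hpar : ∀ i, (2 : ℤ) ∣ u i - u 0)
    (hsum : ∑ i, u i = -4 * w)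
    (hnorm : ∑ i, z i ^ 2 + ∑ i, u i ^ 2 = w ^ 2 + 4) : w = 0 := by
  have hz : 0 ≤ ∑ i, z i ^ 2 := Finset.sum_nonneg fun i _ => sq_nonneg _
  have hc := sq_le_of_sum_eq hsum
  have hw1 : w ≤ 5 := by nlinarith
  have hw2 : -5 ≤ w := by nlinarith
  rcases Int.even_or_odd (u 0) with h0 | h0
  · have he : ∀ i, ∃ k, u i = 2 * k := fun i => by
      obtain ⟨a, ha⟩ := h0
      obtain ⟨b, hb⟩ := hpar i
      exact ⟨a + b, by omega⟩
    have h1 := sum_mul_add_nonneg (u := u) (a := 2) (b := 0) fun i => by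
      obtain ⟨k, hk⟩ := he i
      rw [hk]
      rcases le_or_gt 0 k with h | h <;> nlinarith
    have h2 := sum_mul_add_nonneg (u := u) (a := -2) (b := 0) fun i => by
      obtain ⟨k, hk⟩ := he i
      rw [hk]
      rcases le_or_gt k 0 with h | h <;> nlinarith
    rw [hsum] at h1 h2
    interval_cases w <;> omega
  · have ho : ∀ i, ∃ k, u i = 2 * k + 1 := fun i => by
      obtain ⟨a, ha⟩ := h0
      obtain ⟨b, hb⟩ := hpar i
      exact ⟨a + b, by omega⟩
    have h1 := sum_mul_add_nonneg (u := u) (a := 4) (b := 3) fun i => by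
      obtain ⟨k, hk⟩ := ho i
      rw [hk]
      rcases le_or_gt (-1) k with h | h <;> nlinarith
    have h2 := sum_mul_add_nonneg (u := u) (a := -4) (b := 3) fun i => by
      obtain ⟨k, hk⟩ := ho i
      rw [hk]
      rcases le_or_gt k 0 with h | h <;> nlinarith
    have h3 := sum_mul_add_nonneg (u := u) (a := 0) (b := -1) fun i => by
      obtain ⟨k, hk⟩ := ho i
      rw [hk]
      rcases le_or_gt 0 k with h | h <;> nlinarith
    rw [hsum] at h1 h2 h3
    interval_cases w <;> omega

theorem exists_pos_neg_of_sum_eq_zero (hsum : ∑ i, u i = 0) (hu : u ≠ 0) :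
    ∃ i j, 0 < u i ∧ u j < 0 := by
  obtain ⟨k, hk⟩ := Function.ne_iff.1 hu
  obtain ⟨i, -, hi⟩ := Finset.exists_pos_of_sum_zero_of_exists_nonzero u hsum
    ⟨k, Finset.mem_univ k, hk⟩
  obtain ⟨j, -, hj⟩ := Finset.exists_pos_of_sum_zero_of_exists_nonzero (fun i => -u i)
    (by simpa using hsum) ⟨k, Finset.mem_univ k, by simpa using hk⟩
  exact ⟨i, j, hi, by simpa using hj⟩

theorem eq_single_sub_single (hsum : ∑ i, u i = 0) (hu : u ≠ 0) (hnorm : ∑ i, u i ^ 2 ≤ 2) :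
    ∃ i j, i ≠ j ∧ u = Pi.single i 1 - Pi.single j 1 := by
  obtain ⟨i, j, hi, hj⟩ := exists_pos_neg_of_sum_eq_zero hsum hu
  have hij : i ≠ j := by rintro rfl; omega
  have hle : ∀ s : Finset (Fin 14), ∑ k ∈ s, u k ^ 2 ≤ 2 := fun s =>
    (Finset.sum_le_univ_sum_of_nonneg fun k => sq_nonneg (u k)).trans hnorm
  have h2 := hle {i, j}
  rw [Finset.sum_pair hij] at h2
  refine ⟨i, j, hij, funext fun k => ?_⟩
  by_cases hki : k = i
  · subst hki
    simp only [Pi.sub_apply, Pi.single_eq_same, Pi.single_eq_of_ne hij]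
    nlinarith
  by_cases hkj : k = j
  · subst hkj
    simp only [Pi.sub_apply, Pi.single_eq_same, Pi.single_eq_of_ne hki]
    nlinarith
  · have h3 := hle {k, i, j}
    rw [Finset.sum_insert (by simp [hki, hkj]), Finset.sum_pair hij] at h3
    simp only [Pi.sub_apply, Pi.single_eq_of_ne hki, Pi.single_eq_of_ne hkj]
    have : u k ^ 2 ≤ 0 := by nlinarith
    simpa using pow_eq_zero_iff two_ne_zero |>.1 (le_antisymm this (sq_nonneg _))

/-- The coordinates of `chamberVec` corresponding to `coordU`. -/
def chamberU : Fin 14 → ℤ := ![0, 1, 2, 3, 4, 5, 6, 7, 8, 9, 10, 11, 12, 14]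

/-- The coordinates of `chamberVec` corresponding to `coordZ`. -/
def chamberZ : Fin 3 → ℤ := ![1, 2, 4]

theorem not_dvd_dotProduct_chamberZ (hz : ∑ i, z i ^ 2 = 2 ∨ ∑ i, z i ^ 2 = 4) :
    ¬ (17 : ℤ) ∣ z ⬝ᵥ chamberZ := by
  have h : z ⬝ᵥ chamberZ = z 0 + 2 * z 1 + 4 * z 2 := by
    simp only [dotProduct, Fin.sum_univ_three, chamberZ, cons_val]
    ring
  rw [h]
  simp only [Fin.sum_univ_three] at hz
  generalize z 0 = a at *
  generalize z 1 = b at *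
  generalize z 2 = c at *
  have hle : a ^ 2 + b ^ 2 + c ^ 2 ≤ 4 := by omega
  obtain ⟨ha1, ha2⟩ : a ≤ 2 ∧ -2 ≤ a := ⟨by nlinarith, by nlinarith⟩
  obtain ⟨hb1, hb2⟩ : b ≤ 2 ∧ -2 ≤ b := ⟨by nlinarith, by nlinarith⟩
  obtain ⟨hc1, hc2⟩ : c ≤ 2 ∧ -2 ≤ c := ⟨by nlinarith, by nlinarith⟩
  clear h hle
  interval_cases a <;> interval_cases b <;> interval_cases c <;> omega

theorem sum_sq_single_sub_single {i j : Fin 14} (hij : i ≠ j) :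
    ∑ k, (Pi.single i 1 - Pi.single j 1 : Fin 14 → ℤ) k ^ 2 = 2 := by
  revert i j
  decide +kernel

theorem not_dvd_chamberU_sub {i j : Fin 14} (hij : i ≠ j) :
    ¬ (17 : ℤ) ∣ chamberU i - chamberU j := by
  revert i j
  decide +kernel

theorem not_dvd_of_norm_two (hsum : ∑ i, u i = 0)
    (hnorm : ∑ i, z i ^ 2 + ∑ i, u i ^ 2 = 2) :
    ¬ (17 : ℤ) ∣ z ⬝ᵥ chamberZ + u ⬝ᵥ chamberU := by
  have hz : 0 ≤ ∑ i, z i ^ 2 := Finset.sum_nonneg fun i _ => sq_nonneg _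
  by_cases hu : u = 0
  · subst hu
    rw [zero_dotProduct, add_zero]
    exact not_dvd_dotProduct_chamberZ (Or.inl (by simpa using hnorm))
  · obtain ⟨i, j, hij, rfl⟩ := eq_single_sub_single hsum hu (by omega)
    have hz0 : z = 0 := by
      have h2 := sum_sq_single_sub_single hij
      have : ∑ k, z k ^ 2 = 0 := by omega
      rw [Finset.sum_eq_zero_iff_of_nonneg fun k _ => sq_nonneg _] at this
      exact funext fun k => by simpa using this k (Finset.mem_univ k)
    rw [hz0, zero_dotProduct, zero_add, sub_dotProduct, single_dotProduct, single_dotProduct,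
      one_mul, one_mul]
    exact not_dvd_chamberU_sub hij

theorem not_dvd_of_norm_four (hpar : ∀ i, (2 : ℤ) ∣ u i - u 0) (hsum : ∑ i, u i = 0)
    (hnorm : ∑ i, z i ^ 2 + ∑ i, u i ^ 2 = 4) :
    ¬ (17 : ℤ) ∣ z ⬝ᵥ chamberZ + u ⬝ᵥ chamberU := by
  have hz : 0 ≤ ∑ i, z i ^ 2 := Finset.sum_nonneg fun i _ => sq_nonneg _
  have hu : u = 0 := by
    by_contra hu
    obtain ⟨i, j, hi, hj⟩ := exists_pos_neg_of_sum_eq_zero hsum hu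
    rcases Int.even_or_odd (u 0) with ⟨a, ha⟩ | ⟨a, ha⟩
    · obtain ⟨b, hb⟩ := hpar i
      obtain ⟨c, hc⟩ := hpar j
      have hij : i ≠ j := by rintro rfl; omega
      have h2 : u i ^ 2 + u j ^ 2 ≤ ∑ k, u k ^ 2 := by
        rw [← Finset.sum_pair hij (f := fun k => u k ^ 2)]
        exact Finset.sum_le_univ_sum_of_nonneg fun k => sq_nonneg (u k)
      have h3 : 2 ≤ u i := by omega
      have h4 : u j ≤ -2 := by omega
      nlinarith
    · have h3 := sum_mul_add_nonneg (u := u) (a := 0) (b := -1) fun i => by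
        obtain ⟨b, hb⟩ := hpar i
        have hi : u i = 2 * (a + b) + 1 := by omega
        rw [hi]
        rcases le_or_gt 0 (a + b) with h | h <;> nlinarith
      omega
  subst hu
  rw [zero_dotProduct, add_zero]
  exact not_dvd_dotProduct_chamberZ (Or.inr (by simpa using hnorm))

end ShortVectors

theorem gramS_eq : gramS = vecMulVec pairE pairF + vecMulVec pairF pairE - coordZᵀ * coordZ -
    coordUᵀ * coordU + vecMulVec coordW coordW := by
  decide +kernel

theorem gramS_isSymm : gramS.IsSymm := by
  decide +kernel

theorem bform_gramS (x y : Fin 19 → ℤ) :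
    bform gramS x y = (pairE ⬝ᵥ x) * (pairF ⬝ᵥ y) + (pairF ⬝ᵥ x) * (pairE ⬝ᵥ y) -
      (coordZ *ᵥ x) ⬝ᵥ (coordZ *ᵥ y) - (coordU *ᵥ x) ⬝ᵥ (coordU *ᵥ y) +
      (coordW ⬝ᵥ x) * (coordW ⬝ᵥ y) := by
  rw [bform, gramS_eq]
  simp only [add_mulVec, sub_mulVec, vecMulVec_mulVec, ← mulVec_mulVec, dotProduct_add,
    dotProduct_sub]
  simp only [dotProduct_mulVec x, vecMul_transpose, op_smul_eq_smul, dotProduct_smul, smul_eq_mul]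
  simp only [dotProduct_comm x]
  ring

theorem bform_gramS_self (x : Fin 19 → ℤ) :
    bform gramS x x = 2 * (pairE ⬝ᵥ x) * (pairF ⬝ᵥ x) -
      ∑ i, (coordZ *ᵥ x) i ^ 2 - ∑ i, (coordU *ᵥ x) i ^ 2 + (coordW ⬝ᵥ x) ^ 2 := by
  rw [bform_gramS]
  simp only [dotProduct, sq]
  ring

theorem sum_coordU (x : Fin 19 → ℤ) : ∑ i, (coordU *ᵥ x) i = -4 * (coordW ⬝ᵥ x) := by
  have h : 1 ᵥ* coordU = (-4 : ℤ) • coordW := by decide +kernel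
  rw [← one_dotProduct, dotProduct_mulVec, h, smul_dotProduct, smul_eq_mul]

theorem bform_cuspVec (x : Fin 19 → ℤ) : bform gramS x cuspVec = pairE ⬝ᵥ x := by
  rw [bform_gramS, show pairF ⬝ᵥ cuspVec = 1 by decide +kernel,
    show pairE ⬝ᵥ cuspVec = 0 by decide +kernel, show coordZ *ᵥ cuspVec = 0 by decide +kernel,
    show coordU *ᵥ cuspVec = 0 by decide +kernel, show coordW ⬝ᵥ cuspVec = 0 by decide +kernel]
  simp

theorem bform_chamberVec (x : Fin 19 → ℤ) :
    bform gramS x chamberVec = 44 * (pairE ⬝ᵥ x) + 17 * (pairF ⬝ᵥ x) -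
      (coordZ *ᵥ x) ⬝ᵥ chamberZ - (coordU *ᵥ x) ⬝ᵥ chamberU - 23 * (coordW ⬝ᵥ x) := by
  rw [bform_gramS, show pairF ⬝ᵥ chamberVec = 44 by decide +kernel,
    show pairE ⬝ᵥ chamberVec = 17 by decide +kernel,
    show coordZ *ᵥ chamberVec = chamberZ by decide +kernel,
    show coordU *ᵥ chamberVec = chamberU by decide +kernel,
    show coordW ⬝ᵥ chamberVec = -23 by decide +kernel]
  ring

theorem bform_transVec (x : Fin 19 → ℤ) : bform gramS x transVec = 2 * (coordW ⬝ᵥ x) := by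
  rw [bform_gramS, show pairF ⬝ᵥ transVec = 0 by decide +kernel,
    show pairE ⬝ᵥ transVec = 0 by decide +kernel, show coordZ *ᵥ transVec = 0 by decide +kernel,
    show coordU *ᵥ transVec = (4 : ℤ) • 1 by decide +kernel,
    show coordW ⬝ᵥ transVec = -14 by decide +kernel, dotProduct_smul, dotProduct_one, sum_coordU]
  simp only [dotProduct_zero, smul_eq_mul]
  ring

theorem coordU_parity {x : Fin 19 → ℤ} (hx : ∀ y, (2 : ℤ) ∣ bform gramS x y) (i : Fin 14) :
    (2 : ℤ) ∣ (coordU *ᵥ x) i - (coordU *ᵥ x) 0 := by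
  have hstep : ∀ k : Fin 13,
      (2 : ℤ) ∣ (coordU *ᵥ x) k.succ - (coordU *ᵥ x) k.castSucc := by
    intro k
    have h : gramS *ᵥ rootsA13 k = coordU k.succ - coordU k.castSucc := by
      revert k
      decide +kernel
    have h2 := hx (rootsA13 k)
    rw [bform, h, dotProduct_comm, sub_dotProduct] at h2
    exact h2
  induction i using Fin.induction with
  | zero => simp
  | succ k ih => simpa using dvd_add (hstep k) ih

theorem bform_nonpos_of_orthogonal_cuspVec {x : Fin 19 → ℤ} (hx : bform gramS x cuspVec = 0) :
    bform gramS x x ≤ 0 := by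
  rw [bform_cuspVec] at hx
  rw [bform_gramS_self, hx]
  have h1 := sq_le_of_sum_eq (sum_coordU x)
  have h2 : 0 ≤ ∑ i, (coordZ *ᵥ x) i ^ 2 := Finset.sum_nonneg fun i _ => sq_nonneg _
  nlinarith [sq_nonneg (coordW ⬝ᵥ x)]

theorem eq_zero_of_isotropic {x : Fin 19 → ℤ} (hx : bform gramS x cuspVec = 0)
    (hxx : bform gramS x x = 0) (hxp : bform gramS x chamberVec = 0) : x = 0 := by
  rw [bform_cuspVec] at hx
  rw [bform_gramS_self, hx] at hxx
  have h1 := sq_le_of_sum_eq (sum_coordU x)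
  have hz : 0 ≤ ∑ i, (coordZ *ᵥ x) i ^ 2 := Finset.sum_nonneg fun i _ => sq_nonneg _
  have hw : (coordW ⬝ᵥ x) ^ 2 = 0 := by nlinarith [sq_nonneg (coordW ⬝ᵥ x)]
  have hu : ∑ i, (coordU *ᵥ x) i ^ 2 = 0 :=
    le_antisymm (by nlinarith) (Finset.sum_nonneg fun i _ => sq_nonneg _)
  have hz : ∑ i, (coordZ *ᵥ x) i ^ 2 = 0 := by nlinarith
  rw [Finset.sum_eq_zero_iff_of_nonneg fun i _ => sq_nonneg _] at hu hz
  have hu : coordU *ᵥ x = 0 := funext fun i => by simpa using hu i (Finset.mem_univ i)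
  have hz : coordZ *ᵥ x = 0 := funext fun i => by simpa using hz i (Finset.mem_univ i)
  have hw : coordW ⬝ᵥ x = 0 := by simpa using hw
  rw [bform_chamberVec, hx, hu, hz, hw] at hxp
  have hf : pairF ⬝ᵥ x = 0 := by simpa using hxp
  have hG : gramS *ᵥ x = 0 := by
    rw [gramS_eq]
    simp only [add_mulVec, sub_mulVec, vecMulVec_mulVec, ← mulVec_mulVec, hx, hu, hz, hw, hf]
    simp
  have h2 : gramSInv * gramS = (2 : ℤ) • 1 := by decide +kernel
  have h3 : (2 : ℤ) • x = 0 := by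
    rw [← one_mulVec x, ← smul_mulVec, ← h2, ← mulVec_mulVec, hG, mulVec_zero]
  exact (smul_eq_zero.1 h3).resolve_left two_ne_zero

theorem root_orthogonal_cuspVec {α : Fin 19 → ℤ} (hα : IsRoot gramS α)
    (he : bform gramS α cuspVec = 0) :
    bform gramS α transVec = 0 ∧ bform gramS α chamberVec ≠ 0 := by
  rw [bform_cuspVec] at he
  have hsum := sum_coordU α
  have hself := bform_gramS_self α
  rw [he] at hself
  suffices h : coordW ⬝ᵥ α = 0 ∧
      ¬ (17 : ℤ) ∣ (coordZ *ᵥ α) ⬝ᵥ chamberZ + (coordU *ᵥ α) ⬝ᵥ chamberU by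
    obtain ⟨hw, hdvd⟩ := h
    refine ⟨by rw [bform_transVec, hw, mul_zero], fun h => hdvd ⟨pairF ⬝ᵥ α, ?_⟩⟩
    rw [bform_chamberVec, he, hw] at h
    linarith
  rcases hα with h | ⟨h, h2⟩
  · have hw := timelike_eq_zero_of_norm_two (z := coordZ *ᵥ α) hsum (by linarith)
    rw [hw] at hsum hself
    exact ⟨hw, not_dvd_of_norm_two (by simpa using hsum) (by linarith)⟩
  · have hpar := coordU_parity h2
    have hw := timelike_eq_zero_of_norm_four (z := coordZ *ᵥ α) hpar hsum (by linarith)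
    rw [hw] at hsum hself
    exact ⟨hw, not_dvd_of_norm_four hpar (by simpa using hsum) (by linarith)⟩

/-- The lattice `U ⊕ E₈ ⊕ E₇ ⊕ A₁ ⊕ A₁` is not reflective: the subgroup `W_r` of `O(S)`
generated by the reflections in all roots has infinite index in `O(S)`. -/
theorem not_reflective_19_3_1 : ¬ (Wr _ gramS).FiniteIndex := by
  have hpe : bform gramS chamberVec cuspVec = 17 := by decide +kernel
  have hpp : bform gramS chamberVec chamberVec = 1158 := by decide +kernel
  exact not_finiteIndex_Wr_of_cusp (e := cuspVec) (p := chamberVec) (v := transVec) (k := -14)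
    gramS_isSymm (by decide +kernel) (by rw [hpe]; norm_num) (by rw [hpe, hpp]; norm_num)
    (fun _ => bform_nonpos_of_orthogonal_cuspVec) (fun _ => eq_zero_of_isotropic)
    (by decide +kernel) (by decide +kernel) (by norm_num)
    (fun _ => root_orthogonal_cuspVec)
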